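/- For all integers a, b ≥ 1, the complete bipartite graph K_{a,b} satisfies ζ(K_{a,b}) = min(a, b). -/

import Mathlib

noncomputable section

open SimpleGraph

/-- The closed neighborhood `N[A]` of a set `A` of vertices of a graph. -/
def closedNbhd {V : Type*} (G : SimpleGraph V) (A : Set V) : Set V :=
  {x | ∃ a ∈ A, a = x ∨ G.Adj a x}

/-- A robber walk: at every time step the robber stays put or moves to an adjacent vertex. -/
def IsRobberWalk {V : Type*} (G : SimpleGraph V) (w : ℕ → V) : Prop :=
  ∀ t, w (t + 1) = w t ∨ G.Adj (w t) (w (t + 1))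
/-- The answer the cop player receives when probing the set `S` of vertices while the
robber is at vertex `r`: for each probed vertex, its graph distance to `r`. -/
def probeAnswer {V : Type*} [DecidableEq V] (G : SimpleGraph V) (S : Finset V) (r : V) :
    V → Option ℕ :=
  fun v => if v ∈ S then some (G.dist v r) else none

/-- The list of answers the cop player has received after `t` rounds, when playing
strategy `σ` (which maps each finite history of answers to the next probed set)
against the robber walk `w`.  In round `t` the robber occupies `w t`. -/
def answerHistory {V : Type*} [DecidableEq V] (G : SimpleGraph V)
    (σ : List (V → Option ℕ) → Finset V) (w : ℕ → V) : ℕ → List (V → Option ℕ)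
  | 0 => []
  | t + 1 =>
      answerHistory G σ w t ++ [probeAnswer G (σ (answerHistory G σ w t)) (w t)]

/-- The cop player with strategy `σ` locates the robber walk `w`: at some round `t`,
every robber walk consistent with all the answers received so far occupies the same
vertex as `w` does at round `t`. -/
def Locates {V : Type*} [DecidableEq V] (G : SimpleGraph V)
    (σ : List (V → Option ℕ) → Finset V) (w : ℕ → V) : Prop :=
  ∃ t, ∀ w', IsRobberWalk G w' →
    answerHistory G σ w' (t + 1) = answerHistory G σ w (t + 1) → w' t = w t

/-- The cop player wins the localization game on `G` with `k` cops: there is a strategy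
probing at most `k` vertices per round that locates every robber walk after finitely
many rounds. -/
def LocGameWin {V : Type*} [DecidableEq V] (G : SimpleGraph V) (k : ℕ) : Prop :=
  ∃ σ : List (V → Option ℕ) → Finset V,
    (∀ h, (σ h).card ≤ k) ∧ ∀ w, IsRobberWalk G w → Locates G σ w

/-- The localization number `ζ(G)`: the least number of cops with which the cop player
wins the localization game on `G`. -/
def locNumber {V : Type*} [DecidableEq V] (G : SimpleGraph V) : ℕ :=
  sInf {k | LocGameWin G k}

/-- Two-coloured description of a complete bipartite graph. -/
def IsCB {V : Type*} (G : SimpleGraph V) (c : V → Bool) : Prop :=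
  (∀ u v, G.Adj u v ↔ c u ≠ c v) ∧ ∀ z, ∃ v, c v = z

lemma IsCB.dist_ne {V : Type*} {G : SimpleGraph V} {c : V → Bool} (h : IsCB G c) {u v : V}
    (huv : c u ≠ c v) : G.dist u v = 1 :=
  SimpleGraph.dist_eq_one_iff_adj.2 ((h.1 u v).2 huv)

lemma IsCB.dist_eq {V : Type*} {G : SimpleGraph V} {c : V → Bool} (h : IsCB G c) {u v : V}
    (huv : c u = c v) (hne : u ≠ v) : G.dist u v = 2 := by
  obtain ⟨m, hm⟩ := h.2 (!(c u))
  have h1 : G.Adj u m := (h.1 _ _).2 (by rw [hm]; simp)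
  have h2 : G.Adj m v := (h.1 _ _).2 (by rw [hm, ← huv]; simp)
  have hle : G.dist u v ≤ 2 :=
    SimpleGraph.dist_le (SimpleGraph.Walk.cons h1 (SimpleGraph.Walk.cons h2 SimpleGraph.Walk.nil))
  have h0 : G.dist u v ≠ 0 := by
    intro h0
    exact hne (((h1.reachable.trans h2.reachable).dist_eq_zero_iff).1 h0)
  have h1' : G.dist u v ≠ 1 := by
    intro h1'
    exact (h.1 _ _).1 (SimpleGraph.dist_eq_one_iff_adj.1 h1') huv
  omega

lemma answerHistory_length {V : Type*} [DecidableEq V] (G : SimpleGraph V)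
    (σ : List (V → Option ℕ) → Finset V) (w : ℕ → V) (t : ℕ) :
    (answerHistory G σ w t).length = t := by
  induction t with
  | zero => rfl
  | succ t ih => simp [answerHistory, ih]

lemma IsCB.win {V : Type*} [DecidableEq V] [Fintype V] {G : SimpleGraph V} {c : V → Bool}
    (h : IsCB G c) (z : Bool) : LocGameWin G (Finset.univ.filter (fun v => c v = z)).card := by
  obtain ⟨a0, ha0⟩ := h.2 z
  obtain ⟨b0, hb0⟩ := h.2 (!z)
  haveI : Nonempty {v // c v = !z} := ⟨⟨b0, hb0⟩⟩
  obtain ⟨f, hf⟩ := exists_surjective_nat {v // c v = !z}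
  have ha0m : a0 ∈ Finset.univ.filter (fun v => c v = z) := by simp [ha0]
  refine ⟨fun l => insert (f l.length).1 ((Finset.univ.filter (fun v => c v = z)).erase a0),
    ?_, ?_⟩
  · intro l
    refine (Finset.card_insert_le _ _).trans ?_
    rw [Finset.card_erase_add_one ha0m]
  · intro w hw
    have key : ∀ t, (c (w t) = z ∨ w t = (f t).1) → Locates G (fun l => insert (f l.length).1
        ((Finset.univ.filter (fun v => c v = z)).erase a0)) w := by
      intro t ht
      refine ⟨t, fun w' _ he => ?_⟩
      simp only [answerHistory, answerHistory_length] at he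
      have he2 := (List.append_inj' he rfl).2
      simp only [List.cons.injEq, and_true] at he2
      have hd : ∀ v, (v = (f t).1 ∨ (v ≠ a0 ∧ c v = z)) → G.dist v (w' t) = G.dist v (w t) := by
        intro v hv
        have := congrFun he2 v
        have hm : v ∈ insert (f t).1 ((Finset.univ.filter (fun v => c v = z)).erase a0) := by
          simpa using hv
        simpa [probeAnswer, hm] using this
      have hft : c (f t).1 = !z := (f t).2
      have hzero : ∀ u v, G.dist u v = 0 → u = v := by
        intro u v h0
        by_contra hne
        by_cases hc : c u = c v
        · have := h.dist_eq hc hne; omega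
        · have := h.dist_ne hc; omega
      rcases ht with ht | ht
      · have h1 := hd _ (Or.inl rfl)
        rw [h.dist_ne (u := (f t).1) (v := w t) (by rw [hft, ht]; simp)] at h1
        have hc' : c (w' t) = z := by
          have := (h.1 _ _).1 (SimpleGraph.dist_eq_one_iff_adj.1 h1)
          rw [hft] at this
          revert this; cases c (w' t) <;> cases z <;> simp
        by_cases hwa : w t = a0
        · by_cases hwa' : w' t = a0
          · rw [hwa, hwa']
          · have := hd (w' t) (Or.inr ⟨hwa', hc'⟩)
            rw [SimpleGraph.dist_self] at this
            exact hzero _ _ this.symm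
        · have := hd (w t) (Or.inr ⟨hwa, ht⟩)
          rw [SimpleGraph.dist_self] at this
          exact (hzero _ _ this).symm
      · have h1 := hd _ (Or.inl rfl)
        rw [← ht, SimpleGraph.dist_self] at h1
        exact (hzero _ _ h1).symm
    by_cases hA : ∃ t, c (w t) = z
    · obtain ⟨t, ht⟩ := hA
      exact key t (Or.inl ht)
    · push Not at hA
      have hconst : ∀ t, w t = w 0 := by
        intro t
        induction t with
        | zero => rfl
        | succ t ih =>
          rcases hw t with h1 | h1
          · rw [h1, ih]
          · exfalso
            have h2 := (h.1 _ _).1 h1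
            have h3 := hA t
            have h4 := hA (t + 1)
            revert h2 h3 h4
            cases c (w t) <;> cases c (w (t + 1)) <;> cases z <;> simp
      have h0 : c (w 0) = !z := by
        have := hA 0
        revert this; cases c (w 0) <;> cases z <;> simp
      obtain ⟨t, ht⟩ := hf ⟨w 0, h0⟩
      exact key t (Or.inr (by rw [hconst t, ht]))

/-- A pair of indistinguishable walks defeats the cops. -/
lemma not_win_of_pairs {V : Type*} [DecidableEq V] (G : SimpleGraph V) (k : ℕ)
    (P : V × V → Prop) (hP : ∀ p, P p → p.1 ≠ p.2) (p0 : V × V) (hp0 : P p0)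
    (step : ∀ (S : Finset V) (p : V × V), S.card ≤ k → P p → ∃ q : V × V, P q ∧
      (q.1 = p.1 ∨ G.Adj p.1 q.1) ∧ (q.2 = p.2 ∨ G.Adj p.2 q.2) ∧
      probeAnswer G S q.1 = probeAnswer G S q.2) : ¬ LocGameWin G k := by
  rintro ⟨σ, hσ, hwin⟩
  choose! F hF1 hF2 hF3 hF4 using step
  let st : ℕ → (V × V) × List (V → Option ℕ) := fun t => Nat.rec (F (σ []) p0, [])
    (fun _ s => (F (σ (s.2 ++ [probeAnswer G (σ s.2) s.1.1])) s.1,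
      s.2 ++ [probeAnswer G (σ s.2) s.1.1])) t
  have hs : ∀ t, st (t + 1) = (F (σ ((st t).2 ++ [probeAnswer G (σ (st t).2) (st t).1.1])) (st t).1,
      (st t).2 ++ [probeAnswer G (σ (st t).2) (st t).1.1]) := fun t => rfl
  have hPt : ∀ t, P (st t).1 := by
    intro t
    induction t with
    | zero => exact hF1 _ _ (hσ _) hp0
    | succ t ih => rw [hs]; exact hF1 _ _ (hσ _) ih
  have hans : ∀ t, probeAnswer G (σ (st t).2) (st t).1.1 = probeAnswer G (σ (st t).2) (st t).1.2 := by
    intro t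
    cases t with
    | zero => exact hF4 _ _ (hσ _) hp0
    | succ t => rw [hs]; exact hF4 _ _ (hσ _) (hPt t)
  have hh1 : ∀ t, answerHistory G σ (fun t => (st t).1.1) t = (st t).2 := by
    intro t
    induction t with
    | zero => rfl
    | succ t ih => rw [hs, answerHistory, ih]
  have hh2 : ∀ t, answerHistory G σ (fun t => (st t).1.2) t = (st t).2 := by
    intro t
    induction t with
    | zero => rfl
    | succ t ih => rw [hs, answerHistory, ih, hans]
  have hw1 : IsRobberWalk G (fun t => (st t).1.1) := by
    intro t
    simp only [hs]
    exact hF2 _ _ (hσ _) (hPt t)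
  have hw2 : IsRobberWalk G (fun t => (st t).1.2) := by
    intro t
    simp only [hs]
    exact hF3 _ _ (hσ _) (hPt t)
  obtain ⟨t, ht⟩ := hwin _ hw1
  exact hP _ (hPt t) (ht _ hw2 (by rw [hh1, hh2])).symm

lemma IsCB.not_win {V : Type*} [DecidableEq V] [Fintype V] {G : SimpleGraph V} {c : V → Bool}
    (h : IsCB G c) (k : ℕ) (hk : ∀ z, k < (Finset.univ.filter (fun v => c v = z)).card) :
    ¬ LocGameWin G k := by
  rcases Nat.eq_zero_or_pos k with rfl | hpos
  · obtain ⟨x, hx⟩ := h.2 true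
    obtain ⟨y, hy⟩ := h.2 false
    refine not_win_of_pairs G 0 (fun p => p.1 ≠ p.2) (fun _ => id) (x, y) ?_ ?_
    · intro hxy
      have hxy' : x = y := hxy
      rw [← hxy', hx] at hy
      simp at hy
    · intro S p hS hp
      have : S = ∅ := by simpa using hS
      subst this
      exact ⟨p, hp, Or.inl rfl, Or.inl rfl, by funext v; simp [probeAnswer]⟩
  · obtain ⟨x, hx, y, hy, hxy⟩ := Finset.one_lt_card.1 (lt_of_le_of_lt hpos (hk true))
    simp only [Finset.mem_filter, Finset.mem_univ, true_and] at hx hy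
    refine not_win_of_pairs G k (fun p => p.1 ≠ p.2 ∧ c p.1 = c p.2) (fun _ hp => hp.1) (x, y)
      ⟨hxy, by rw [hx, hy]⟩ ?_
    rintro S ⟨u, v⟩ hS ⟨huv, hc⟩
    simp only at huv hc
    set B := Finset.univ.filter (fun w => c w = !(c u)) with hB
    by_cases h2 : 1 < (B \ S).card
    · obtain ⟨u', hu', v', hv', hne⟩ := Finset.one_lt_card.1 h2
      simp only [hB, Finset.mem_sdiff, Finset.mem_filter, Finset.mem_univ, true_and] at hu' hv'
      refine ⟨(u', v'), ⟨hne, by simp [hu'.1, hv'.1]⟩, Or.inr ?_, Or.inr ?_, ?_⟩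
      · exact (h.1 _ _).2 (by simp [hu'.1])
      · exact (h.1 _ _).2 (by simp [hv'.1, ← hc])
      · funext s
        unfold probeAnswer
        split_ifs with hs
        · congr 1
          have h1 : s ≠ u' := by rintro rfl; exact hu'.2 hs
          have h3 : s ≠ v' := by rintro rfl; exact hv'.2 hs
          by_cases hcs : c s = c u'
          · rw [h.dist_eq hcs h1, h.dist_eq (by rw [hcs, hu'.1, hv'.1]) h3]
          · rw [h.dist_ne hcs, h.dist_ne (by rw [hv'.1, ← hu'.1]; exact hcs)]
        · rfl
    · have hsub : S ⊆ B := by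
        have e1 := Finset.card_sdiff_add_card_inter B S
        have e2 := hk (!(c u))
        rw [← hB] at e2
        have e3 : S.card ≤ (B ∩ S).card := by omega
        have e4 := Finset.eq_of_subset_of_card_le Finset.inter_subset_right e3
        rw [← e4]; exact Finset.inter_subset_left
      refine ⟨(u, v), ⟨huv, hc⟩, Or.inl rfl, Or.inl rfl, ?_⟩
      funext s
      unfold probeAnswer
      split_ifs with hs
      · have hsB := hsub hs
        simp only [hB, Finset.mem_filter, Finset.mem_univ, true_and] at hsB
        rw [h.dist_ne (v := u) (by simp [hsB]), h.dist_ne (v := v) (by simp [hsB, ← hc])]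
      · rfl

/-- For all `a, b ≥ 1`, the complete bipartite graph `K_{a,b}` satisfies
`ζ(K_{a,b}) = min (a, b)`. -/
theorem locNumber_completeBipartiteGraph (a b : ℕ) (ha : 1 ≤ a) (hb : 1 ≤ b) :
    locNumber (completeBipartiteGraph (Fin a) (Fin b)) = min a b := by
  have h : IsCB (completeBipartiteGraph (Fin a) (Fin b)) (fun v => v.isLeft) := by
    constructor
    · rintro (u | u) (v | v) <;> simp [completeBipartiteGraph]
    · rintro (_ | _)
      · exact ⟨Sum.inr ⟨0, hb⟩, rfl⟩
      · exact ⟨Sum.inl ⟨0, ha⟩, rfl⟩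
  have hca : (Finset.univ.filter (fun v : Fin a ⊕ Fin b => v.isLeft = true)).card = a := by
    rw [Finset.card_filter, Fintype.sum_sum_type]; simp
  have hcb : (Finset.univ.filter (fun v : Fin a ⊕ Fin b => v.isLeft = false)).card = b := by
    rw [Finset.card_filter, Fintype.sum_sum_type]; simp
  have w1 := h.win true
  have w2 := h.win false
  rw [hca] at w1
  rw [hcb] at w2
  apply le_antisymm
  · exact le_min (Nat.sInf_le w1) (Nat.sInf_le w2)
  · refine le_csInf ⟨a, w1⟩ fun k hk => ?_
    by_contra hlt
    push Not at hlt
    refine h.not_win k ?_ hk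
    rintro (_ | _)
    · rw [hcb]; exact lt_of_lt_of_le hlt (min_le_right _ _)
    · rw [hca]; exact lt_of_lt_of_le hlt (min_le_left _ _)
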